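/- Let γ > −1/2. For every complex number a with Im(a) ≠ 0, (2γ+1)·(|₁F₁(γ;2γ+1;ia)|² − |₁F₁(1+γ;2γ+1;ia)|²)/(2·Im(a)) > 0; moreover for every real a one has T(a) > 0, which is the interpretation of the left-hand side by continuity when Im(a) = 0. -/

import Mathlib

open MeasureTheory Filter Set Topology ComplexConjugate

noncomputable section

/-- Rising factorial (Pochhammer symbol) `(v)_k`. -/
def risingFac (v : ℂ) (k : ℕ) : ℂ := (ascPochhammer ℂ k).eval v

/-- Real rising factorial. -/
def risingFacR (v : ℝ) (k : ℕ) : ℝ := (ascPochhammer ℝ k).eval v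

/-- The confluent hypergeometric function `₁F₁(a;b;z)`. -/
def oneF1 (a b z : ℂ) : ℂ :=
  ∑' k : ℕ, risingFac a k / risingFac b k * z ^ k / (Nat.factorial k : ℂ)

/-- The terminating Gauss hypergeometric sum `₂F₁(-m, c; d; x)`. -/
def twoF1t (m : ℕ) (c d x : ℂ) : ℂ :=
  ∑ k ∈ Finset.range (m + 1), (m.choose k : ℂ) * (risingFac c k / risingFac d k) * (-x) ^ k

/-- Real version of the terminating Gauss hypergeometric sum. -/
def twoF1tR (m : ℕ) (c d x : ℝ) : ℝ :=
  ∑ k ∈ Finset.range (m + 1), (m.choose k : ℝ) * (risingFacR c k / risingFacR d k) * (-x) ^ k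

/-- The polynomial reproducing kernel built from a family of polynomials. -/
def repKernel (φ : ℕ → Polynomial ℂ) (n : ℕ) (z w : ℂ) : ℂ :=
  ∑ j ∈ Finset.range (n + 1), (φ j).eval z * conj ((φ j).eval w)

/-- `φ` is the family of orthonormal polynomials of `μ`, with (positive real) leading
coefficients `κ`. -/
structure IsOrthonormalPolys (μ : Measure ℂ) (φ : ℕ → Polynomial ℂ) (κ : ℕ → ℝ) : Prop where
  natDegree_eq : ∀ n, (φ n).natDegree = n
  lead_pos : ∀ n, 0 < κ n
  lead_eq : ∀ n, (φ n).leadingCoeff = (κ n : ℂ)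
  orthonormal : ∀ m n, ∫ z, (φ m).eval z * conj ((φ n).eval z) ∂μ = if m = n then 1 else 0

/-- The (closed) support of a measure on `ℂ`. -/
def msupport (μ : Measure ℂ) : Set ℂ := {z | ∀ U : Set ℂ, IsOpen U → z ∈ U → 0 < μ U}

/-- Logarithmic capacity of a compact set, defined via the transfinite diameter. -/
def capacity (K : Set ℂ) : ℝ :=
  ⨅ n : ℕ, ⨆ f : {f : Fin (n + 2) → ℂ // ∀ i, f i ∈ K},
    (∏ p ∈ Finset.univ.filter (fun p : Fin (n + 2) × Fin (n + 2) => p.1 < p.2),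
        ‖f.1 p.1 - f.1 p.2‖) ^ (2 / (((n : ℝ) + 2) * ((n : ℝ) + 1)))

/-- Stahl–Totik regularity of a measure `μ` whose orthonormal polynomials have leading
coefficients `κ`:  `κ n ^ (1/n) → 1 / cap (supp μ)`. -/
def IsRegularST (μ : Measure ℂ) (κ : ℕ → ℝ) : Prop :=
  Tendsto (fun n : ℕ => κ n ^ ((n : ℝ)⁻¹)) atTop (𝓝 (1 / capacity (msupport μ)))

/-- The Christoffel function `λ_n(z; μ)`. -/
def christoffel (μ : Measure ℂ) (n : ℕ) (z : ℂ) : ℝ :=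
  sInf {x : ℝ | ∃ P : Polynomial ℂ, P.natDegree ≤ n ∧ P.eval z = 1 ∧
    x = ∫ w, ‖P.eval w‖ ^ 2 ∂μ}

/-- Arclength measure `dθ` on the unit circle (parametrized over `[0, 2π]`). -/
def circleArc : Measure ℂ :=
  Measure.map (fun θ : ℝ => Complex.exp (Complex.I * θ)) (volume.restrict (Icc (0:ℝ) (2 * Real.pi)))

/-- The measure `w(θ) dθ/(2π)` on the unit circle. -/
def circleAC (w : ℝ → ℝ) : Measure ℂ :=
  Measure.map (fun θ : ℝ => Complex.exp (Complex.I * θ))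
    ((volume.restrict (Icc (0:ℝ) (2 * Real.pi))).withDensity fun θ =>
      ENNReal.ofReal (w θ / (2 * Real.pi)))

/-- The Hua–Pickrell weight. -/
def hpWeight (γ τ : ℝ) (θ : ℝ) : ℝ :=
  (4:ℝ) ^ γ * ‖Complex.Gamma (1 + (γ:ℂ) + Complex.I * (τ:ℂ))‖ ^ 2
      / Real.Gamma (2 * γ + 1)
    * Real.exp ((Real.pi - θ) * τ) * Real.sin (θ / 2) ^ (2 * γ)

/-- The Hua–Pickrell measure on the unit circle. -/
def huaPickrell (γ τ : ℝ) : Measure ℂ := circleAC (hpWeight γ τ)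

/-- The limiting kernel appearing in Theorem 1.1, with the diagonal `a = b̄` interpreted
by continuity. -/
def hpLimitKernel (γ τ : ℝ) (a b : ℂ) : ℂ :=
  let y : ℂ := (γ:ℂ) + Complex.I * (τ:ℂ)
  let c : ℂ := 2 * (γ:ℂ) + 1
  if a = conj b then
    oneF1 (1 + conj y) c (-Complex.I * conj b) * oneF1 (2 + y) (c + 1) (Complex.I * conj b)
        * (1 + y)
      - oneF1 (conj y) c (-Complex.I * conj b) * oneF1 (1 + y) (c + 1) (Complex.I * conj b) * y
  else
    c * (oneF1 (conj y) c (-Complex.I * conj b) * oneF1 y c (Complex.I * a)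
        - oneF1 (1 + conj y) c (-Complex.I * conj b) * oneF1 (1 + y) c (Complex.I * a))
      / (Complex.I * (conj b - a))

/-- The lemniscate region `G_{r,m} = {z : |z^m - 1| < r^m}`. -/
def lemniscate (r : ℝ) (m : ℕ) : Set ℂ := {z : ℂ | ‖z ^ m - 1‖ < r ^ m}

/-- The function `H = ₁F₁(2;3;·)`. -/
def Hfun (t : ℂ) : ℂ := if t = 0 then 1 else 2 * (Complex.exp t * (t - 1) + 1) / t ^ 2

/-- The function `T` of (2.1). -/
def Tfun (γ : ℝ) (a : ℝ) : ℂ :=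
  oneF1 (1 + (γ:ℂ)) (2 * (γ:ℂ) + 1) (-Complex.I * (a:ℂ))
      * oneF1 (2 + (γ:ℂ)) (2 * (γ:ℂ) + 2) (Complex.I * (a:ℂ)) * (1 + (γ:ℂ))
    - oneF1 (γ:ℂ) (2 * (γ:ℂ) + 1) (-Complex.I * (a:ℂ))
      * oneF1 (1 + (γ:ℂ)) (2 * (γ:ℂ) + 2) (Complex.I * (a:ℂ)) * (γ:ℂ)

end


lemma aux_pos (c : ℝ) (R R' : ℝ → ℝ) (L : ℝ) (hL : 0 < L)
    (hlim : Tendsto R (𝓝[>] 0) (𝓝 L))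
    (hd : ∀ t, 0 < t → HasDerivAt R (R' t) t)
    (hn : ∀ t, 0 < t → 0 ≤ t * R' t + c * R t) : ∀ t, 0 < t → 0 < R t := by
  intro t ht
  have hder : ∀ s, 0 < s → HasDerivAt (fun x => x ^ c * R x) (c * s ^ (c - 1) * R s + s ^ c * R' s) s :=
    fun s hs => (Real.hasDerivAt_rpow_const (Or.inl hs.ne')).mul (hd s hs)
  have hmono : MonotoneOn (fun x => x ^ c * R x) (Ioi 0) := by
    apply monotoneOn_of_deriv_nonneg (convex_Ioi 0)
    · intro s hs
      exact (hder s hs).continuousAt.continuousWithinAt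
    · intro s hs
      rw [interior_Ioi] at hs
      exact (hder s hs).differentiableAt.differentiableWithinAt
    · intro s hs
      rw [interior_Ioi] at hs
      have hs' : 0 < s := hs
      rw [(hder s hs).deriv]
      have h1 : s ^ c = s ^ (c - 1) * s := by
        rw [← Real.rpow_add_one hs'.ne']; simp
      rw [h1]
      have := mul_nonneg (Real.rpow_nonneg hs'.le (c - 1)) (hn s hs')
      linarith
  have hev : ∀ᶠ s in 𝓝[>] (0:ℝ), 0 < R s := hlim.eventually (lt_mem_nhds hL)
  have hev2 : ∀ᶠ s in 𝓝[>] (0:ℝ), s ∈ Ioo 0 t := Ioo_mem_nhdsGT ht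
  obtain ⟨s, h1, h2⟩ := (hev.and hev2).exists
  have h3 := hmono (show s ∈ Ioi 0 from h2.1) (show t ∈ Ioi 0 from ht) h2.2.le
  have h4 : 0 < s ^ c * R s := mul_pos (Real.rpow_pos_of_pos h2.1 c) h1
  have h5 : 0 < t ^ c * R t := lt_of_lt_of_le h4 h3
  exact (mul_pos_iff_of_pos_left (Real.rpow_pos_of_pos ht c)).1 h5

lemma slope_lim (f : ℝ → ℝ) (d : ℝ) (h : HasDerivAt f d 0) (h0 : f 0 = 0) :
    Tendsto (fun t => f t / t) (𝓝[>] 0) (𝓝 d) := by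
  have := (hasDerivAt_iff_tendsto_slope.1 h).mono_left (nhdsWithin_mono 0 (fun x (hx : (0:ℝ) < x) => hx.ne'))
  refine this.congr ?_
  intro x
  simp [slope_def_field, h0]

lemma sq_deriv {f : ℝ → ℝ} {d t : ℝ} (h : HasDerivAt f d t) :
    HasDerivAt (fun t => f t ^ 2) (2 * f t * d) t := by
  have := h.fun_pow 2
  simpa using this

section
variable (γ u v : ℝ) (p1 p2 q1 q2 p1' p2' q1' q2' : ℝ → ℝ)
  (hp1 : ∀ t, HasDerivAt p1 (p1' t) t) (hp2 : ∀ t, HasDerivAt p2 (p2' t) t)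
  (hq1 : ∀ t, HasDerivAt q1 (q1' t) t) (hq2 : ∀ t, HasDerivAt q2 (q2' t) t)
  (ep1 : ∀ t, t * p1' t = γ * (q1 t - p1 t))
  (ep2 : ∀ t, t * p2' t = γ * (q2 t - p2 t))
  (eq1 : ∀ t, t * q1' t = γ * (p1 t - q1 t) + t * (u * q1 t - v * q2 t))
  (eq2 : ∀ t, t * q2' t = γ * (p2 t - q2 t) + t * (u * q2 t + v * q1 t))
  (zp1 : p1 0 = 1) (zq1 : q1 0 = 1) (zp2 : p2 0 = 0) (zq2 : q2 0 = 0)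
  (dp1 : p1' 0 = u * γ / (2 * γ + 1)) (dp2 : p2' 0 = v * γ / (2 * γ + 1))
  (dq1 : q1' 0 = u * (1 + γ) / (2 * γ + 1)) (dq2 : q2' 0 = v * (1 + γ) / (2 * γ + 1))
  (hc : 0 < 2 * γ + 1)

include hp1 hp2 hq1 hq2 ep1 ep2 eq1 eq2 zp1 zq1 zp2 zq2 dp1 dq1 hc in
lemma caseD (k δ : ℝ) (hk : 0 < - 2 * u * k / (2 * γ + 1) + δ) (hk' : k * u ≤ 0) (hδ : 0 ≤ δ) :
    0 < k * (p1 1 ^ 2 + p2 1 ^ 2 - (q1 1 ^ 2 + q2 1 ^ 2)) + δ := by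
  have hD : ∀ t, HasDerivAt (fun t => p1 t ^ 2 + p2 t ^ 2 - (q1 t ^ 2 + q2 t ^ 2))
      (2 * p1 t * p1' t + 2 * p2 t * p2' t - (2 * q1 t * q1' t + 2 * q2 t * q2' t)) t := by
    intro t
    exact ((sq_deriv (hp1 t)).add (sq_deriv (hp2 t))).sub ((sq_deriv (hq1 t)).add (sq_deriv (hq2 t)))
  set D := (fun t => p1 t ^ 2 + p2 t ^ 2 - (q1 t ^ 2 + q2 t ^ 2)) with hDdef
  have key := aux_pos (2 * γ + 1) (fun t => k * (D t / t) + δ)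
    (fun t => k * (((2 * p1 t * p1' t + 2 * p2 t * p2' t - (2 * q1 t * q1' t + 2 * q2 t * q2' t)) * t - D t * 1) / t ^ 2))
    (k * (2 * p1 0 * p1' 0 + 2 * p2 0 * p2' 0 - (2 * q1 0 * q1' 0 + 2 * q2 0 * q2' 0)) + δ) ?_ ?_ ?_ ?_ 1 one_pos
  · simpa [hDdef] using key
  · rw [zp1, zp2, zq1, zq2, dp1, dq1]
    convert hk using 1
    ring
  · exact ((slope_lim D _ (hD 0) (by simp [hDdef, zp1, zp2, zq1, zq2])).const_mul k).add_const δ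
  · intro t ht
    exact (((hD t).div (hasDerivAt_id t) ht.ne').const_mul k).add_const δ
  · intro t ht
    have e : t * (k * (((2 * p1 t * p1' t + 2 * p2 t * p2' t - (2 * q1 t * q1' t + 2 * q2 t * q2' t)) * t - D t * 1) / t ^ 2)) + (2 * γ + 1) * (k * (D t / t) + δ)
      = -(2 * (k * u)) * (q1 t ^ 2 + q2 t ^ 2) + (2 * γ + 1) * δ := by
      have : (2 * p1 t * p1' t + 2 * p2 t * p2' t - (2 * q1 t * q1' t + 2 * q2 t * q2' t)) * t
        = -2 * γ * D t - 2 * t * u * (q1 t ^ 2 + q2 t ^ 2) := by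
        simp only [hDdef]
        linear_combination 2 * p1 t * ep1 t + 2 * p2 t * ep2 t - 2 * q1 t * eq1 t - 2 * q2 t * eq2 t
      rw [this]
      field_simp
      ring
    rw [e]
    have : 0 ≤ -(k*u) * (q1 t ^ 2 + q2 t ^ 2) := mul_nonneg (by linarith) (by positivity)
    have : 0 ≤ (2 * γ + 1) * δ := by positivity
    linarith

include hp1 hp2 hq1 hq2 ep1 ep2 eq1 eq2 zp1 zq1 zp2 zq2 dp2 dq2 hc in
lemma caseT (hu : u = 0) (hv : v ≠ 0) :
    0 < q1 1 ^ 2 + q2 1 ^ 2 + 2 * γ / v * (q1 1 * p2 1 - q2 1 * p1 1) := by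
  subst hu
  have hD : ∀ t, HasDerivAt (fun t => q1 t * p2 t - q2 t * p1 t)
      (q1' t * p2 t + q1 t * p2' t - (q2' t * p1 t + q2 t * p1' t)) t := by
    intro t
    exact ((hq1 t).mul (hp2 t)).sub ((hq2 t).mul (hp1 t))
  have hN : ∀ t, HasDerivAt (fun t => q1 t ^ 2 + q2 t ^ 2)
      (2 * q1 t * q1' t + 2 * q2 t * q2' t) t := by
    intro t
    exact (sq_deriv (hq1 t)).add (sq_deriv (hq2 t))
  set D := (fun t => q1 t * p2 t - q2 t * p1 t) with hDdef
  set N := (fun t => q1 t ^ 2 + q2 t ^ 2) with hNdef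
  have key := aux_pos (2 * γ + 1) (fun t => N t + 2 * γ / v * (D t / t))
    (fun t => (2 * q1 t * q1' t + 2 * q2 t * q2' t) + 2 * γ / v * (((q1' t * p2 t + q1 t * p2' t - (q2' t * p1 t + q2 t * p1' t)) * t - D t * 1) / t ^ 2))
    (N 0 + 2 * γ / v * (q1' 0 * p2 0 + q1 0 * p2' 0 - (q2' 0 * p1 0 + q2 0 * p1' 0))) ?_ ?_ ?_ ?_ 1 one_pos
  · simpa [hDdef, hNdef] using key
  · simp only [hNdef]
    rw [zp1, zp2, zq1, zq2, dp2, dq2]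
    have : (1:ℝ) ^ 2 + 0 ^ 2 + 2 * γ / v * (q1' 0 * 0 + 1 * (v * γ / (2 * γ + 1)) - (v * (1 + γ) / (2 * γ + 1) * 1 + 0 * p1' 0)) = 1 / (2 * γ + 1) := by
      field_simp
      ring
    rw [this]
    positivity
  · exact ((hN 0).continuousAt.tendsto.mono_left nhdsWithin_le_nhds).add
      ((slope_lim D _ (hD 0) (by simp [hDdef, zp2, zq2])).const_mul _)
  · intro t ht
    exact (hN t).add (((hD t).div (hasDerivAt_id t) ht.ne').const_mul _)
  · intro t ht
    have e : t * ((2 * q1 t * q1' t + 2 * q2 t * q2' t) + 2 * γ / v * (((q1' t * p2 t + q1 t * p2' t - (q2' t * p1 t + q2 t * p1' t)) * t - D t * 1) / t ^ 2)) + (2 * γ + 1) * (N t + 2 * γ / v * (D t / t))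
      = q1 t ^ 2 + q2 t ^ 2 := by
      have h1 : (q1' t * p2 t + q1 t * p2' t - (q2' t * p1 t + q2 t * p1' t)) * t
        = -2 * γ * D t - t * v * (q1 t * p1 t + q2 t * p2 t) := by
        simp only [hDdef]
        linear_combination p2 t * eq1 t + q1 t * ep2 t - p1 t * eq2 t - q2 t * ep1 t
      have h2 : t * (2 * q1 t * q1' t + 2 * q2 t * q2' t) = 2 * γ * (q1 t * p1 t + q2 t * p2 t - N t) := by
        simp only [hNdef]
        linear_combination 2 * q1 t * eq1 t + 2 * q2 t * eq2 t
      rw [mul_add, h2, h1]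
      simp only [hNdef]
      field_simp
      ring
    rw [e]
    positivity
end

lemma rf_zero (v : ℂ) : risingFac v 0 = 1 := by simp [risingFac]

lemma rf_succ (v : ℂ) (k : ℕ) : risingFac v (k + 1) = risingFac v k * (v + k) := by
  simp [risingFac, ascPochhammer_succ_eval]

lemma rf_succ_left (v : ℂ) (k : ℕ) : risingFac v (k + 1) = v * risingFac (v + 1) k := by
  simp [risingFac, ascPochhammer_succ_left, Polynomial.eval_comp]

lemma rf_shift (v : ℂ) (k : ℕ) : v * risingFac (v + 1) k = risingFac v k * (v + k) := by
  rw [← rf_succ_left, rf_succ]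

lemma bk_ne (b : ℂ) (hb : 0 < b.re) (k : ℕ) : b + k ≠ 0 := by
  intro h
  have := congrArg Complex.re h
  simp at this
  have hk : (0:ℝ) ≤ k := k.cast_nonneg
  linarith

lemma rf_ne (b : ℂ) (hb : 0 < b.re) (k : ℕ) : risingFac b k ≠ 0 := by
  induction k with
  | zero => simp [rf_zero]
  | succ k ih => rw [rf_succ]; exact mul_ne_zero ih (bk_ne b hb k)

lemma rf_conj (r : ℝ) (k : ℕ) : (starRingEnd ℂ) (risingFac (r:ℂ) k) = risingFac (r:ℂ) k := by
  induction k with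
  | zero => simp [rf_zero]
  | succ k ih => rw [rf_succ]; simp [ih]

lemma oneF1_conj (a b : ℝ) (z : ℂ) :
    oneF1 a b ((starRingEnd ℂ) z) = (starRingEnd ℂ) (oneF1 a b z) := by
  unfold oneF1
  rw [Complex.conj_tsum]
  refine tsum_congr fun k => ?_
  simp [rf_conj]

noncomputable def fterm (a b : ℂ) (k : ℕ) (z : ℂ) : ℂ :=
  risingFac a k / risingFac b k * z ^ k / (Nat.factorial k : ℂ)

lemma fterm_succ (a b : ℂ) (hb : 0 < b.re) (k : ℕ) (z : ℂ) :
    fterm a b (k + 1) z = ((a + k) / (b + k) * z / (k + 1)) * fterm a b k z := by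
  have h1 := rf_ne b hb k
  have h2 := bk_ne b hb k
  have h3 : (Nat.factorial k : ℂ) ≠ 0 := by exact_mod_cast Nat.factorial_ne_zero k
  have h4 : ((k:ℂ) + 1) ≠ 0 := by exact_mod_cast Nat.succ_ne_zero k
  unfold fterm
  rw [rf_succ, rf_succ, Nat.factorial_succ]
  push_cast
  field_simp
  ring

lemma fterm_summable (a b : ℂ) (hb : 0 < b.re) (z : ℂ) : Summable (fun k => fterm a b k z) := by
  apply summable_of_ratio_norm_eventually_le (r := 1/2) (by norm_num)
  obtain ⟨N, hN⟩ := exists_nat_ge (2 * ‖z‖ * (‖a‖ + 1))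
  filter_upwards [eventually_ge_atTop (N + 1)] with k hk
  rw [fterm_succ a b hb, norm_mul]
  apply mul_le_mul_of_nonneg_right _ (norm_nonneg _)
  have hk1 : (1:ℝ) ≤ k := by exact_mod_cast (by omega : 1 ≤ k)
  have hkN : (N:ℝ) ≤ k := by exact_mod_cast (by omega : N ≤ k)
  have hbk : (k:ℝ) ≤ ‖b + k‖ := by
    have := Complex.re_le_norm (b + k)
    simp at this
    linarith
  have hak : ‖a + k‖ ≤ (‖a‖ + 1) * k := by
    have := norm_add_le a (k:ℂ)
    simp at this
    nlinarith [norm_nonneg a]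
  have hk1' : ‖(k:ℂ) + 1‖ = (k:ℝ) + 1 := by
    exact_mod_cast Complex.norm_natCast (k + 1)
  rw [norm_div, norm_mul, norm_div, hk1', div_le_iff₀ (by linarith)]
  have h1 : ‖a + k‖ / ‖b + k‖ ≤ ‖a‖ + 1 := by
    rw [div_le_iff₀ (by linarith)]
    exact hak.trans (by gcongr)
  have := mul_le_mul_of_nonneg_right h1 (norm_nonneg z)
  linarith

lemma fterm_deriv (a b : ℂ) (k : ℕ) (z : ℂ) :
    HasDerivAt (fterm a b k) (risingFac a k / risingFac b k * (k * z ^ (k - 1)) / (Nat.factorial k : ℂ)) z := by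
  unfold fterm
  exact ((hasDerivAt_pow k z).const_mul _).div_const _

lemma fterm_bound (a b : ℂ) (k : ℕ) (r : ℝ) (z : ℂ) (hz : ‖z‖ ≤ r) :
    ‖fterm a b k z‖ ≤ ‖fterm a b k (r:ℂ)‖ := by
  have hr : 0 ≤ r := (norm_nonneg z).trans hz
  unfold fterm
  simp only [norm_div, norm_mul, norm_pow, Complex.norm_real, Real.norm_of_nonneg hr]
  gcongr

lemma oneF1_hasDerivAt_aux (a b : ℂ) (hb : 0 < b.re) (z : ℂ) :
    DifferentiableAt ℂ (oneF1 a b) z ∧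
    HasSum (fun k : ℕ => risingFac a k / risingFac b k * (k * z ^ (k - 1)) / (Nat.factorial k : ℂ))
      (deriv (oneF1 a b) z) := by
  have hu := (fterm_summable a b hb ((‖z‖ + 1 : ℝ) : ℂ)).norm
  have hz : z ∈ Metric.ball (0:ℂ) (‖z‖ + 1) := by simp
  have hf : ∀ i : ℕ, DifferentiableOn ℂ (fterm a b i) (Metric.ball (0:ℂ) (‖z‖ + 1)) :=
    fun i w _ => (fterm_deriv a b i w).differentiableAt.differentiableWithinAt
  have hle : ∀ (i : ℕ) (w : ℂ), w ∈ Metric.ball (0:ℂ) (‖z‖ + 1) →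
      ‖fterm a b i w‖ ≤ ‖fterm a b i ((‖z‖ + 1 : ℝ) : ℂ)‖ := by
    intro i w hw
    apply fterm_bound
    simpa using (mem_ball_zero_iff.1 hw).le
  constructor
  · exact (Complex.differentiableOn_tsum_of_summable_norm hu hf Metric.isOpen_ball hle).differentiableAt
      (Metric.isOpen_ball.mem_nhds hz)
  · have := Complex.hasSum_deriv_of_summable_norm hu hf Metric.isOpen_ball hle hz
    simp only [(fterm_deriv a b _ z).deriv] at this
    exact this

lemma oneF1_hasSum (a b : ℂ) (hb : 0 < b.re) (z : ℂ) :
    HasSum (fun k => fterm a b k z) (oneF1 a b z) := (fterm_summable a b hb z).hasSum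

lemma oneF1_zero (a b : ℂ) (hb : 0 < b.re) : oneF1 a b 0 = 1 := by
  have h := oneF1_hasSum a b hb 0
  refine h.unique ?_
  have : fterm a b 0 0 = 1 := by simp [fterm, rf_zero]
  rw [← this]
  apply hasSum_single
  intro k hk
  simp [fterm, hk]

lemma oneF1_deriv (a b : ℂ) (hb : 0 < b.re) (z : ℂ) :
    HasDerivAt (oneF1 a b) (a / b * oneF1 (a + 1) (b + 1) z) z := by
  obtain ⟨h1, h2⟩ := oneF1_hasDerivAt_aux a b hb z
  convert! h1.hasDerivAt using 1
  rw [← hasSum_nat_add_iff' 1] at h2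
  have h3 := (oneF1_hasSum (a + 1) (b + 1) (by simp; linarith) z).mul_left (a / b)
  simp only [Finset.range_one, Finset.sum_singleton] at h2
  refine (h3.unique ?_)
  convert! h2 using 1
  · funext k
    have hb0 : b ≠ 0 := by simpa using bk_ne b hb 0
    have hb1 : risingFac (b + 1) k ≠ 0 := rf_ne _ (by simp; linarith) k
    have h3 : (Nat.factorial k : ℂ) ≠ 0 := by exact_mod_cast Nat.factorial_ne_zero k
    have h4 : ((k:ℂ) + 1) ≠ 0 := by exact_mod_cast Nat.succ_ne_zero k
    unfold fterm
    rw [rf_succ_left, rf_succ_left, Nat.factorial_succ]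
    push_cast
    field_simp
  · simp

lemma zderiv_hasSum (a b : ℂ) (hb : 0 < b.re) (z : ℂ) :
    HasSum (fun k : ℕ => (k:ℂ) * fterm a b k z) (z * (a / b * oneF1 (a + 1) (b + 1) z)) := by
  rw [← (oneF1_deriv a b hb z).deriv]
  convert! (oneF1_hasDerivAt_aux a b hb z).2.mul_left z using 1
  funext k
  unfold fterm
  rcases k with _ | k
  · simp
  · simp only [Nat.add_sub_cancel]
    ring

lemma ode1 (a b : ℂ) (hb : 0 < b.re) (z : ℂ) :
    z * (a / b * oneF1 (a + 1) (b + 1) z) = a * (oneF1 (a + 1) b z - oneF1 a b z) := by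
  refine (zderiv_hasSum a b hb z).unique ?_
  convert! ((oneF1_hasSum (a+1) b hb z).sub (oneF1_hasSum a b hb z)).mul_left a using 1
  funext k
  unfold fterm
  linear_combination - (z ^ k / (risingFac b k * (Nat.factorial k : ℂ))) * rf_shift a k

lemma ode2 (g : ℂ) (hb : 0 < (2 * g + 1).re) (z : ℂ) :
    z * ((1 + g) / (2 * g + 1) * oneF1 (1 + g + 1) (2 * g + 1 + 1) z)
      = g * (oneF1 g (2 * g + 1) z - oneF1 (1 + g) (2 * g + 1) z) + z * oneF1 (1 + g) (2 * g + 1) z := by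
  set b := 2 * g + 1 with hbdef
  have h1 := (zderiv_hasSum (1 + g) b hb z).sub
    (((oneF1_hasSum g b hb z).sub (oneF1_hasSum (1 + g) b hb z)).mul_left g)
  have h2 := (oneF1_hasSum (1 + g) b hb z).mul_left z
  rw [← sub_eq_iff_eq_add']
  rw [← hasSum_nat_add_iff' 1] at h1
  simp only [Finset.range_one, Finset.sum_singleton] at h1
  have h0 : ∀ x, fterm x b 0 z = 1 := fun x => by simp [fterm, rf_zero]
  rw [h0, h0] at h1
  simp only [Nat.cast_zero, zero_mul, sub_self, mul_zero, sub_zero] at h1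
  refine h1.unique ?_
  convert! h2 using 1
  funext k
  have hb1 : risingFac b k ≠ 0 := rf_ne _ hb k
  have hb2 := bk_ne b hb k
  have h3 : (Nat.factorial k : ℂ) ≠ 0 := by exact_mod_cast Nat.factorial_ne_zero k
  have h4 : ((k:ℂ) + 1) ≠ 0 := by exact_mod_cast Nat.succ_ne_zero k
  unfold fterm
  rw [rf_succ_left g, rf_succ (1 + g), rf_succ b, Nat.factorial_succ, add_comm g 1]
  push_cast
  field_simp
  rw [hbdef]
  ring

lemma ray_deriv (F : ℂ → ℂ) (F' : ℂ → ℂ) (h : ∀ z, HasDerivAt F (F' z) z) (w : ℂ) (t : ℝ) :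
    HasDerivAt (fun t : ℝ => (F (t * w)).re) (w * F' (t * w)).re t ∧
    HasDerivAt (fun t : ℝ => (F (t * w)).im) (w * F' (t * w)).im t := by
  have h1 : HasDerivAt (fun z : ℂ => F (z * w)) (F' (t * w) * (1 * w)) (t:ℂ) :=
    (h (t * w)).comp (t:ℂ) ((hasDerivAt_id (t:ℂ)).mul_const w)
  have h2 := h1.comp_ofReal
  have e : F' (t * w) * (1 * w) = w * F' (t * w) := by ring
  rw [e] at h2
  exact ⟨Complex.reCLM.hasFDerivAt.comp_hasDerivAt t h2, Complex.imCLM.hasFDerivAt.comp_hasDerivAt t h2⟩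

lemma main_aux (γ : ℝ) (hc : 0 < 2 * γ + 1) (w : ℂ) :
    (∀ k δ : ℝ, 0 < - 2 * w.re * k / (2 * γ + 1) + δ → k * w.re ≤ 0 → 0 ≤ δ →
      0 < k * ((oneF1 γ (2 * γ + 1) w).re ^ 2 + (oneF1 γ (2 * γ + 1) w).im ^ 2
        - ((oneF1 (1 + γ) (2 * γ + 1) w).re ^ 2 + (oneF1 (1 + γ) (2 * γ + 1) w).im ^ 2)) + δ) ∧
    (w.re = 0 → w.im ≠ 0 →
      0 < (oneF1 (1 + γ) (2 * γ + 1) w).re ^ 2 + (oneF1 (1 + γ) (2 * γ + 1) w).im ^ 2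
        + 2 * γ / w.im * ((oneF1 (1 + γ) (2 * γ + 1) w).re * (oneF1 γ (2 * γ + 1) w).im
          - (oneF1 (1 + γ) (2 * γ + 1) w).im * (oneF1 γ (2 * γ + 1) w).re)) := by
  have hb : 0 < (2 * (γ:ℂ) + 1).re := by simpa using hc
  have hb' : 0 < (2 * (γ:ℂ) + 1 + 1).re := by simp at hb ⊢; linarith
  have hF := ray_deriv _ _ (oneF1_deriv (γ:ℂ) (2 * γ + 1) hb) w
  have hG := ray_deriv _ _ (oneF1_deriv (1 + (γ:ℂ)) (2 * γ + 1) hb) w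
  have o1 : ∀ t : ℝ, (t:ℂ) * (w * ((γ:ℂ) / (2 * γ + 1) * oneF1 (γ + 1) (2 * γ + 1 + 1) (t * w)))
      = γ * (oneF1 (1 + γ) (2 * γ + 1) (t * w) - oneF1 γ (2 * γ + 1) (t * w)) := by
    intro t
    have := ode1 (γ:ℂ) (2 * γ + 1) hb (t * w)
    rw [add_comm 1 (γ:ℂ), ← this]; ring
  have o2 : ∀ t : ℝ, (t:ℂ) * (w * ((1 + (γ:ℂ)) / (2 * γ + 1) * oneF1 (1 + γ + 1) (2 * γ + 1 + 1) (t * w)))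
      = γ * (oneF1 γ (2 * γ + 1) (t * w) - oneF1 (1 + γ) (2 * γ + 1) (t * w))
        + t * (w * oneF1 (1 + γ) (2 * γ + 1) (t * w)) := by
    intro t
    have := ode2 (γ:ℂ) hb (t * w)
    linear_combination this
  have e1 : (γ:ℂ) / (2 * γ + 1) = ((γ / (2 * γ + 1) : ℝ) : ℂ) := by push_cast; rfl
  have e2 : (1 + (γ:ℂ)) / (2 * γ + 1) = (((1 + γ) / (2 * γ + 1) : ℝ) : ℂ) := by push_cast; rfl
  have ep1 := fun t : ℝ => congrArg Complex.re (o1 t)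
  have ep2 := fun t : ℝ => congrArg Complex.im (o1 t)
  have eq1 := fun t : ℝ => congrArg Complex.re (o2 t)
  have eq2 := fun t : ℝ => congrArg Complex.im (o2 t)
  simp only [Complex.re_ofReal_mul, Complex.im_ofReal_mul, Complex.add_re, Complex.add_im,
    Complex.sub_re, Complex.sub_im] at ep1 ep2 eq1 eq2
  simp only [Complex.mul_re w (oneF1 _ _ _), Complex.mul_im w (oneF1 _ _ _)] at eq1 eq2
  have z1 : oneF1 (γ:ℂ) (2 * γ + 1) ((0:ℝ) * w) = 1 := by simp [oneF1_zero _ _ hb]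
  have z2 : oneF1 (1 + (γ:ℂ)) (2 * γ + 1) ((0:ℝ) * w) = 1 := by simp [oneF1_zero _ _ hb]
  have z3 : oneF1 ((γ:ℂ) + 1) (2 * γ + 1 + 1) ((0:ℝ) * w) = 1 := by simp [oneF1_zero _ _ hb']
  have z4 : oneF1 (1 + (γ:ℂ) + 1) (2 * γ + 1 + 1) ((0:ℝ) * w) = 1 := by simp [oneF1_zero _ _ hb']
  constructor
  · intro k δ h1 h2 h3
    have := caseD γ w.re w.im _ _ _ _ _ _ _ _ (fun t => (hF t).1) (fun t => (hF t).2)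
      (fun t => (hG t).1) (fun t => (hG t).2) ep1 ep2 eq1
      (fun t => by rw [eq2 t])
      (by rw [z1]; simp) (by rw [z2]; simp) (by rw [z1]; simp) (by rw [z2]; simp)
      (by rw [z3, e1, mul_one, Complex.re_mul_ofReal]; ring)
      (by rw [z4, e2, mul_one, Complex.re_mul_ofReal]; ring) hc k δ h1 h2 h3
    simpa only [Complex.ofReal_one, one_mul] using this
  · intro h1 h2
    have := caseT γ w.re w.im _ _ _ _ _ _ _ _ (fun t => (hF t).1) (fun t => (hF t).2)
      (fun t => (hG t).1) (fun t => (hG t).2) ep1 ep2 eq1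
      (fun t => by rw [eq2 t])
      (by rw [z1]; simp) (by rw [z2]; simp) (by rw [z1]; simp) (by rw [z2]; simp)
      (by rw [z3, e1, mul_one, Complex.im_mul_ofReal]; ring)
      (by rw [z4, e2, mul_one, Complex.im_mul_ofReal]; ring) hc h1 h2
    simpa only [Complex.ofReal_one, one_mul] using this

lemma T_formula (γ a : ℝ) (hc : 0 < 2 * γ + 1) (ha : a ≠ 0) :
    ∃ r : ℝ, 0 < r ∧ Tfun γ a = (r : ℂ) := by
  have hb : 0 < (2 * (γ:ℂ) + 1).re := by simpa using hc
  obtain ⟨hD, hT⟩ := main_aux γ hc (Complex.I * a)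
  have hre : (Complex.I * (a:ℂ)).re = 0 := by simp
  have him : (Complex.I * (a:ℂ)).im = a := by simp
  rw [hre] at hD hT
  rw [him] at hT
  have hT' := hT rfl ha
  have o1 := ode1 (γ:ℂ) (2 * γ + 1) hb (Complex.I * a)
  have o2 := ode2 (γ:ℂ) hb (Complex.I * a)
  have cc : (starRingEnd ℂ) (Complex.I * (a:ℂ)) = -Complex.I * a := by simp
  have c1 := oneF1_conj γ (2 * γ + 1) (Complex.I * a)
  have c2 := oneF1_conj (1 + γ) (2 * γ + 1) (Complex.I * a)
  rw [cc] at c1 c2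
  push_cast at c1 c2
  unfold Tfun
  rw [c1, c2]
  have n1 : (γ:ℂ) + 1 = 1 + γ := by ring
  have n2 : 1 + (γ:ℂ) + 1 = 2 + γ := by ring
  have n3 : 2 * (γ:ℂ) + 1 + 1 = 2 * γ + 2 := by ring
  rw [n1, n3] at o1
  rw [n2, n3] at o2
  have hc0 : (2 * (γ:ℂ) + 1) ≠ 0 := by intro h; rw [h] at hb; simp at hb
  have hz : Complex.I * (a:ℂ) ≠ 0 := by simp [ha]
  generalize oneF1 (γ:ℂ) (2 * γ + 1) (Complex.I * a) = F at *
  generalize oneF1 (1 + (γ:ℂ)) (2 * γ + 1) (Complex.I * a) = G at *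
  generalize oneF1 (1 + (γ:ℂ)) (2 * γ + 2) (Complex.I * a) = F1 at *
  generalize oneF1 (2 + (γ:ℂ)) (2 * γ + 2) (Complex.I * a) = G1 at *
  have D0 : F.re ^ 2 + F.im ^ 2 = G.re ^ 2 + G.im ^ 2 := by
    apply le_antisymm
    · apply le_of_forall_pos_le_add
      intro δ hδ
      have := hD (-1) δ (by simpa using hδ) (by simp) hδ.le
      linarith
    · apply le_of_forall_pos_le_add
      intro δ hδ
      have := hD 1 δ (by simpa using hδ) (by simp) hδ.le
      linarith
  refine ⟨(2 * γ + 1) * (G.re ^ 2 + G.im ^ 2 + 2 * γ / a * (G.re * F.im - G.im * F.re)), mul_pos hc hT', ?_⟩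
  apply mul_left_cancel₀ hz
  have s1 : Complex.I * (a:ℂ) * ((starRingEnd ℂ) G * G1 * (1 + γ) - (starRingEnd ℂ) F * F1 * γ)
      = (2 * γ + 1) * ((starRingEnd ℂ) G * (γ * (F - G) + Complex.I * a * G) - (starRingEnd ℂ) F * (γ * (G - F))) := by
    rw [← o1, ← o2]
    generalize 2 * (γ:ℂ) + 1 = K at hc0 ⊢
    field_simp
  rw [s1]
  have s2 : (2 * (γ:ℂ) + 1) = ((2 * γ + 1 : ℝ) : ℂ) := by push_cast; rfl
  rw [s2]
  obtain ⟨q, hq⟩ : ∃ q, q = G.re ^ 2 + G.im ^ 2 + 2 * γ / a * (G.re * F.im - G.im * F.re) := ⟨_, rfl⟩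
  have hq' : a * q = a * (G.re ^ 2 + G.im ^ 2) + 2 * γ * (G.re * F.im - G.im * F.re) := by
    rw [hq]; field_simp
  rw [← hq, Complex.ofReal_mul]
  apply Complex.ext
  · simp only [Complex.mul_re, Complex.mul_im, Complex.add_re, Complex.add_im, Complex.sub_re, Complex.sub_im, Complex.I_re, Complex.I_im, Complex.ofReal_re, Complex.ofReal_im, Complex.conj_re, Complex.conj_im]
    linear_combination (2 * γ + 1) * γ * D0
  · simp only [Complex.mul_re, Complex.mul_im, Complex.add_re, Complex.add_im, Complex.sub_re, Complex.sub_im, Complex.I_re, Complex.I_im, Complex.ofReal_re, Complex.ofReal_im, Complex.conj_re, Complex.conj_im]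
    linear_combination -(2 * γ + 1) * hq'

/-- **Lemma 2.4.** Strict positivity of the diagonal limiting kernel. -/
theorem statement_8 (γ : ℝ) (hγ : -(1/2) < γ) :
    (∀ a : ℂ, a.im ≠ 0 →
      0 < (2 * γ + 1) *
        (‖oneF1 (γ:ℂ) (2 * (γ:ℂ) + 1) (Complex.I * a)‖ ^ 2
          - ‖oneF1 (1 + (γ:ℂ)) (2 * (γ:ℂ) + 1) (Complex.I * a)‖ ^ 2)
        / (2 * a.im)) ∧
    ∀ a : ℝ, (Tfun γ a).im = 0 ∧ 0 < (Tfun γ a).re := by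
  have hc : 0 < 2 * γ + 1 := by linarith
  constructor
  · intro a ha
    have h := (main_aux γ hc (Complex.I * a)).1 (1 / (2 * a.im)) 0
    have hre : (Complex.I * a).re = -a.im := by simp
    rw [hre] at h
    have h' := h (by
      have : -2 * -a.im * (1 / (2 * a.im)) / (2 * γ + 1) + 0 = 1 / (2 * γ + 1) := by field_simp; ring
      rw [this]; positivity) (by
      have : 1 / (2 * a.im) * -a.im = -(1/2) := by field_simp
      rw [this]; norm_num) le_rfl
    rw [add_zero] at h'
    rw [Complex.sq_norm, Complex.sq_norm, Complex.normSq_apply, Complex.normSq_apply]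
    have h2 := mul_pos hc h'
    refine lt_of_lt_of_eq h2 ?_
    ring
  · intro a
    by_cases ha : a = 0
    · subst ha
      have hb : 0 < (2 * (γ:ℂ) + 1).re := by simpa using hc
      have hb' : 0 < (2 * (γ:ℂ) + 2).re := by simp at hb ⊢; linarith
      have : Tfun γ 0 = 1 := by
        simp [Tfun, oneF1_zero _ _ hb, oneF1_zero _ _ hb']
      rw [this]
      simp
    · obtain ⟨r, hr, h⟩ := T_formula γ a hc ha
      rw [h]
      simpa using hr
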